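/- Let m be an odd positive integer. The number of quadruples (x, y, z, w) ∈ ℤ⁴ with x² + y² + 2z² + 2w² = 4m such that x and y are odd and z and w have different parity (one even, one odd) equals 16σ(m). -/

import Mathlib

section

open Finset

/-- The vectors in `ℤᵏ` with odd entries whose squares add up to `M`. -/
noncomputable def oddSquareReps (k : ℕ) (M : ℤ) : Finset (Fin k → ℤ) :=
  {v ∈ Fintype.piFinset fun _ => Icc (-M) M | (∀ i, Odd (v i)) ∧ ∑ i, v i ^ 2 = M}

/-- The pairs `(a, b)` of positive integers with `4ab = M`. -/
noncomputable def quarterFactorizations (M : ℤ) : Finset (ℤ × ℤ) :=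
  {p ∈ Icc 1 M ×ˢ Icc 1 M | 4 * (p.1 * p.2) = M}

/-- The triples `(a, x, b)` with `a, b > 0` and `x² + 4ab = N`, that is, the binary quadratic
forms `aX² + xXY - bY²` of discriminant `N` with `a, b > 0`. -/
noncomputable def indefiniteForms (N : ℤ) : Finset (ℤ × ℤ × ℤ) :=
  {f ∈ Icc 1 N ×ˢ Icc (-N) N ×ˢ Icc 1 N | f.2.1 ^ 2 + 4 * (f.1 * f.2.2) = N}

/-- The forms in `indefiniteForms N` that are negative at `(1, 1)`, given by the absolute values
`(p, q, r)` of their values at `(1, 0)`, `(0, 1)` and `(1, 1)`. -/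
noncomputable def formValues (N : ℤ) : Finset (ℤ × ℤ × ℤ) :=
  {f ∈ Icc 1 N ×ˢ Icc 1 N ×ˢ Icc 1 N | (f.2.1 - f.2.2 - f.1) ^ 2 + 4 * (f.1 * f.2.1) = N}

theorem Int.abs_le_sq (x : ℤ) : |x| ≤ x ^ 2 := by
  rw [← sq_abs]
  nlinarith [abs_nonneg x, Int.one_le_abs (z := x), abs_eq_zero (a := x), eq_or_ne x 0]

theorem mem_oddSquareReps {k : ℕ} {M : ℤ} {v : Fin k → ℤ} :
    v ∈ oddSquareReps k M ↔ (∀ i, Odd (v i)) ∧ ∑ i, v i ^ 2 = M := by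
  simp only [oddSquareReps, mem_filter, Fintype.mem_piFinset, mem_Icc, and_iff_right_iff_imp]
  rintro ⟨-, h⟩ i
  rw [← abs_le, ← h]
  exact (Int.abs_le_sq _).trans
    (single_le_sum (f := fun i => v i ^ 2) (fun j _ => sq_nonneg (v j)) (mem_univ i))

theorem mem_quarterFactorizations {M a b : ℤ} :
    (a, b) ∈ quarterFactorizations M ↔ 0 < a ∧ 0 < b ∧ 4 * (a * b) = M := by
  simp only [quarterFactorizations, mem_filter, mem_product, mem_Icc]
  constructor
  · rintro ⟨⟨⟨ha, -⟩, hb, -⟩, h⟩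
    exact ⟨ha, hb, h⟩
  · rintro ⟨ha, hb, h⟩
    refine ⟨⟨⟨ha, ?_⟩, hb, ?_⟩, h⟩ <;> nlinarith

theorem mem_indefiniteForms {N a x b : ℤ} :
    (a, x, b) ∈ indefiniteForms N ↔ 0 < a ∧ 0 < b ∧ x ^ 2 + 4 * (a * b) = N := by
  simp only [indefiniteForms, mem_filter, mem_product, mem_Icc]
  constructor
  · rintro ⟨⟨⟨ha, -⟩, -, hb, -⟩, h⟩
    exact ⟨ha, hb, h⟩
  · rintro ⟨ha, hb, h⟩
    have hx := Int.abs_le_sq x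
    have hab := mul_pos ha hb
    refine ⟨⟨⟨ha, ?_⟩, abs_le.1 (by linarith), hb, ?_⟩, h⟩ <;> nlinarith [sq_nonneg x]

theorem mem_formValues {N p q r : ℤ} :
    (p, q, r) ∈ formValues N ↔
      0 < p ∧ 0 < q ∧ 0 < r ∧ (q - r - p) ^ 2 + 4 * (p * q) = N := by
  simp only [formValues, mem_filter, mem_product, mem_Icc]
  constructor
  · rintro ⟨⟨⟨hp, -⟩, ⟨hq, -⟩, hr, -⟩, h⟩
    exact ⟨hp, hq, hr, h⟩
  · rintro ⟨hp, hq, hr, h⟩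
    have hpq := mul_pos hp hq
    have hpr := mul_pos hp hr
    refine ⟨⟨⟨hp, ?_⟩, ⟨hq, ?_⟩, hr, ?_⟩, h⟩ <;>
      nlinarith [sq_nonneg (q - r), sq_nonneg (q - r - p)]

/-- Forms of nonsquare discriminant do not vanish at `(1, 1)`; those positive there are, up to
the symmetry `(a, x, b) ↦ (b, -x, a)`, the negative ones. -/
theorem sum_indefiniteForms_eq_sum_formValues {N : ℤ} (hN : ¬ IsSquare N)
    (H : ℤ → ℤ → ℤ → ℤ) :
    ∑ f ∈ indefiniteForms N, H f.1 f.2.1 f.2.2 =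
      ∑ f ∈ formValues N, (H f.1 (f.2.1 - f.2.2 - f.1) f.2.1 +
        H f.2.1 (f.1 + f.2.2 - f.2.1) f.1) := by
  rw [← sum_filter_add_sum_filter_not _ (fun f => f.1 + f.2.1 - f.2.2 < 0), sum_add_distrib]
  congr 1
  · refine sum_nbij' (fun f => (f.1, f.2.2, f.2.2 - f.1 - f.2.1))
      (fun f => (f.1, f.2.1 - f.2.2 - f.1, f.2.1)) ?_ ?_ ?_ ?_ ?_
    · rintro ⟨a, x, b⟩ h
      simp only [mem_filter, mem_indefiniteForms, mem_formValues] at h ⊢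
      exact ⟨h.1.1, h.1.2.1, by linarith, by linear_combination h.1.2.2⟩
    · rintro ⟨p, q, r⟩ h
      simp only [mem_filter, mem_indefiniteForms, mem_formValues] at h ⊢
      exact ⟨⟨h.1, h.2.1, h.2.2.2⟩, by linarith⟩
    · rintro ⟨a, x, b⟩ -
      simp only [Prod.mk.injEq, true_and, and_true]
      ring
    · rintro ⟨p, q, r⟩ -
      simp only [Prod.mk.injEq, true_and]
      ring
    · rintro ⟨a, x, b⟩ -
      simp only
      congr 1
      ring
  · refine sum_nbij' (fun f => (f.2.2, f.1, f.1 + f.2.1 - f.2.2))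
      (fun f => (f.2.1, f.1 + f.2.2 - f.2.1, f.1)) ?_ ?_ ?_ ?_ ?_
    · rintro ⟨a, x, b⟩ h
      simp only [mem_filter, mem_indefiniteForms, mem_formValues] at h ⊢
      refine ⟨h.1.2.1, h.1.1, lt_of_le_of_ne (by linarith) fun h0 => hN ⟨a + b, ?_⟩,
        by linear_combination h.1.2.2⟩
      have hx : x = b - a := by linarith
      rw [← h.1.2.2, hx]
      ring
    · rintro ⟨p, q, r⟩ h
      simp only [mem_filter, mem_indefiniteForms, mem_formValues] at h ⊢
      exact ⟨⟨h.2.1, h.1, by linear_combination h.2.2.2⟩, by linarith⟩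
    · rintro ⟨a, x, b⟩ -
      simp only [Prod.mk.injEq, true_and, and_true]
      ring
    · rintro ⟨p, q, r⟩ -
      simp only [Prod.mk.injEq, true_and]
      ring
    · rintro ⟨a, x, b⟩ -
      simp only
      congr 1
      ring

theorem sum_indefiniteForms_cubic {N : ℤ} (hN : ¬ IsSquare N) :
    ∑ f ∈ indefiniteForms N, f.1 * (f.1 * f.2.2 - f.2.1 ^ 2) = 0 := by
  have odd_part : ∑ f ∈ indefiniteForms N, f.2.1 * f.1 ^ 2 = 0 := by
    have h : ∑ f ∈ indefiniteForms N, f.2.1 * f.1 ^ 2 =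
        ∑ f ∈ indefiniteForms N, -(f.2.1 * f.1 ^ 2) := by
      refine sum_nbij' (fun f => (f.1, -f.2.1, f.2.2)) (fun f => (f.1, -f.2.1, f.2.2))
        ?_ ?_ ?_ ?_ ?_ <;> rintro ⟨a, x, b⟩ <;> simp [mem_indefiniteForms]
    rw [sum_neg_distrib] at h
    linarith
  have key := sum_indefiniteForms_eq_sum_formValues hN
    (fun a x b => a * (a * b - x ^ 2) - x * a ^ 2)
  rw [sum_sub_distrib, odd_part, sub_zero] at key
  rw [key]
  set F : ℤ × ℤ × ℤ → ℤ := fun f =>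
    f.1 * (f.1 * f.2.1 - (f.2.1 - f.2.2 - f.1) ^ 2) - (f.2.1 - f.2.2 - f.1) * f.1 ^ 2 +
      (f.2.1 * (f.2.1 * f.1 - (f.1 + f.2.2 - f.2.1) ^ 2) -
        (f.1 + f.2.2 - f.2.1) * f.2.1 ^ 2) with hF
  have h : ∑ f ∈ formValues N, F f = ∑ f ∈ formValues N, -F f := by
    refine sum_nbij' (fun f => (f.1, f.2.2, f.2.1)) (fun f => (f.1, f.2.2, f.2.1))
      ?_ ?_ ?_ ?_ ?_
    · rintro ⟨p, q, r⟩ h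
      simp only [mem_formValues] at h ⊢
      exact ⟨h.1, h.2.2.1, h.2.1, by linear_combination h.2.2.2⟩
    · rintro ⟨p, q, r⟩ h
      simp only [mem_formValues] at h ⊢
      exact ⟨h.1, h.2.2.1, h.2.1, by linear_combination h.2.2.2⟩
    · exact fun _ _ => rfl
    · exact fun _ _ => rfl
    · rintro ⟨p, q, r⟩ -
      simp only [hF]
      ring
  rw [sum_neg_distrib] at h
  linarith

theorem sum_quarterFactorizations_recurrence {N : ℤ} (hN : ¬ IsSquare N) :
    ∑ x ∈ Icc (-N) N,
      (N - 5 * x ^ 2) * ∑ p ∈ quarterFactorizations (N - x ^ 2), p.1 = 0 := by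
  have h : ∑ x ∈ Icc (-N) N, ∑ p ∈ quarterFactorizations (N - x ^ 2),
      (N - 5 * x ^ 2) * p.1 =
      ∑ f ∈ indefiniteForms N, 4 * (f.1 * (f.1 * f.2.2 - f.2.1 ^ 2)) := by
    rw [sum_sigma']
    refine sum_nbij' (fun t => (t.2.1, t.1, t.2.2)) (fun f => ⟨f.2.1, f.1, f.2.2⟩)
      ?_ ?_ ?_ ?_ ?_
    · rintro ⟨x, a, b⟩ h
      simp only [mem_sigma, mem_quarterFactorizations, mem_indefiniteForms] at h ⊢
      exact ⟨h.2.1, h.2.2.1, by linarith⟩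
    · rintro ⟨a, x, b⟩ h
      simp only [mem_sigma, mem_quarterFactorizations, mem_indefiniteForms, mem_Icc] at h ⊢
      have hx := Int.abs_le_sq x
      have hab := mul_pos h.1 h.2.1
      exact ⟨abs_le.1 (by linarith), h.1, h.2.1, by linarith⟩
    · exact fun _ _ => rfl
    · exact fun _ _ => rfl
    · rintro ⟨x, a, b⟩ h
      simp only [mem_sigma, mem_quarterFactorizations] at h ⊢
      linear_combination -a * h.2.2.2
  simp only [mul_sum]
  rw [h, ← mul_sum, sum_indefiniteForms_cubic hN, mul_zero]

theorem sum_oddSquareReps_sq_eq {k : ℕ} (N : ℤ) (i j : Fin k) :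
    ∑ v ∈ oddSquareReps k N, v i ^ 2 = ∑ v ∈ oddSquareReps k N, v j ^ 2 := by
  have hmem : ∀ v ∈ oddSquareReps k N, v ∘ Equiv.swap i j ∈ oddSquareReps k N := by
    intro v hv
    rw [mem_oddSquareReps] at hv ⊢
    exact ⟨fun l => hv.1 _, (Equiv.sum_comp (Equiv.swap i j) fun l => v l ^ 2).trans hv.2⟩
  refine sum_nbij' (fun v => v ∘ Equiv.swap i j) (fun v => v ∘ Equiv.swap i j) hmem hmem
    ?_ ?_ ?_
  · intro v _
    ext l
    simp
  · intro v _
    ext l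
    simp
  · intro v _
    simp

theorem sum_oddSquareReps_eq_zero (k : ℕ) (N : ℤ) :
    ∑ v ∈ oddSquareReps (k + 1) N, (N - (k + 1) * v 0 ^ 2) = 0 := by
  have h : ∑ v ∈ oddSquareReps (k + 1) N, N =
      ∑ i : Fin (k + 1), ∑ v ∈ oddSquareReps (k + 1) N, v i ^ 2 := by
    rw [sum_comm]
    exact sum_congr rfl fun v hv => (mem_oddSquareReps.1 hv).2.symm
  rw [sum_sub_distrib, h, sum_congr rfl fun i _ => sum_oddSquareReps_sq_eq N i 0, sum_const,
    ← mul_sum]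
  simp

theorem card_oddSquareReps_recurrence (k : ℕ) (N : ℤ) :
    ∑ x ∈ Icc (-N) N with Odd x,
      (N - (k + 1) * x ^ 2) * (#(oddSquareReps k (N - x ^ 2)) : ℤ) = 0 := by
  rw [← sum_oddSquareReps_eq_zero k N]
  have h : ∀ x : ℤ, (N - (k + 1) * x ^ 2) * (#(oddSquareReps k (N - x ^ 2)) : ℤ) =
      ∑ v ∈ oddSquareReps k (N - x ^ 2), (N - (k + 1) * x ^ 2) := by
    intro x
    rw [sum_const, nsmul_eq_mul, mul_comm]
  simp only [h]
  rw [sum_sigma']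
  refine sum_nbij' (fun t => Fin.cons t.1 t.2) (fun v => ⟨v 0, Fin.tail v⟩) ?_ ?_ ?_ ?_ ?_
  · rintro ⟨x, v⟩ h
    simp only [mem_sigma, mem_filter, mem_oddSquareReps, Fin.forall_fin_succ, Fin.sum_univ_succ,
      Fin.cons_zero, Fin.cons_succ] at h ⊢
    exact ⟨⟨h.1.2, h.2.1⟩, by linarith⟩
  · intro v h
    simp only [mem_sigma, mem_filter, mem_Icc, mem_oddSquareReps, Fin.forall_fin_succ,
      Fin.sum_univ_succ, Fin.tail] at h ⊢
    have hx := Int.abs_le_sq (v 0)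
    have hs : 0 ≤ ∑ i : Fin k, v i.succ ^ 2 := sum_nonneg fun i _ => sq_nonneg _
    exact ⟨⟨abs_le.1 (by linarith), h.1.1⟩, h.1.2, by linarith⟩
  · rintro ⟨x, v⟩ -
    simp
  · intro v _
    simp
  · rintro ⟨x, v⟩ -
    simp

theorem not_isSquare_of_emod_eight_eq_five {N : ℤ} (hN : N % 8 = 5) : ¬ IsSquare N := by
  rintro ⟨r, rfl⟩
  have h : r % 8 = 0 ∨ r % 8 = 1 ∨ r % 8 = 2 ∨ r % 8 = 3 ∨ r % 8 = 4 ∨ r % 8 = 5 ∨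
    r % 8 = 6 ∨ r % 8 = 7 := by omega
  rcases h with h | h | h | h | h | h | h | h <;> simp [Int.mul_emod, h] at hN

/-- The recurrence with weights `N - 5x²` has at most one solution with given value at `4`. -/
theorem eq_zero_of_recurrence {u : ℤ → ℤ} (hneg : ∀ M ≤ 0, u M = 0) (hfour : u 4 = 0)
    (hrec : ∀ N : ℤ, N % 8 = 5 →
      ∑ x ∈ Icc (-N) N with Odd x, (N - 5 * x ^ 2) * u (N - x ^ 2) = 0)
    (m : ℕ) (hm : Odd m) : u (4 * m) = 0 := by
  induction m using Nat.strong_induction_on with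
  | _ m ih =>
    obtain rfl | hne := eq_or_ne m 1
    · simpa using hfour
    have hm3 : 3 ≤ m := by
      obtain ⟨k, rfl⟩ := hm
      omega
    have hmod : (4 * (m : ℤ) + 1) % 8 = 5 := by
      obtain ⟨k, rfl⟩ := hm
      push_cast
      omega
    have h := hrec (4 * m + 1) hmod
    have hsub : ({1, -1} : Finset ℤ) ⊆ {x ∈ Icc (-(4 * (m : ℤ) + 1)) (4 * m + 1) | Odd x} := by
      intro x hx
      simp only [mem_insert, mem_singleton] at hx
      simp only [mem_filter, mem_Icc]
      rcases hx with rfl | rfl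
      · exact ⟨by omega, by decide⟩
      · exact ⟨by omega, by decide⟩
    rw [← sum_subset hsub, sum_pair (by decide)] at h
    · norm_num at h
      exact h.resolve_left (by omega)
    · intro x hx hx1
      simp only [mem_insert, mem_singleton, mem_filter, mem_Icc, not_or] at hx hx1
      rw [mul_eq_zero]
      right
      rcases le_or_gt (4 * (m : ℤ) + 1 - x ^ 2) 0 with hle | hlt
      · exact hneg _ hle
      obtain ⟨j, hj⟩ := Int.eight_dvd_sq_sub_one_of_odd hx.2
      have hj0 : 0 < j := by
        have : 1 < x ^ 2 := by
          rw [one_lt_sq_iff_one_lt_abs]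
          rcases hx.2 with ⟨l, rfl⟩
          rw [lt_abs]
          omega
        omega
      obtain ⟨n, hn⟩ : ∃ n : ℕ, (n : ℤ) = m - 2 * j := ⟨(m - 2 * j : ℤ).toNat, by omega⟩
      have hu := ih n (by omega) (by
        rw [← Int.odd_coe_nat, hn]
        exact ((Int.odd_coe_nat m).2 hm).sub_even (even_two_mul j))
      rw [show 4 * (m : ℤ) + 1 - x ^ 2 = 4 * n by rw [hn]; linarith]
      exact hu

theorem card_oddSquareReps_four_eq_sum (m : ℕ) (hm : Odd m) :
    (#(oddSquareReps 4 (4 * m)) : ℤ) = 16 * ∑ p ∈ quarterFactorizations (4 * m), p.1 := by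
  refine sub_eq_zero.1 (eq_zero_of_recurrence
    (u := fun M => (#(oddSquareReps 4 M) : ℤ) - 16 * ∑ p ∈ quarterFactorizations M, p.1)
    ?_ ?_ ?_ m hm)
  · intro M hM
    have h1 : oddSquareReps 4 M = ∅ := by
      refine eq_empty_of_forall_notMem fun v hv => ?_
      rw [mem_oddSquareReps] at hv
      have hpos : 0 < ∑ i, v i ^ 2 := sum_pos
        (fun i _ => sq_pos_of_ne_zero fun h0 => by simpa [h0] using hv.1 i) univ_nonempty
      omega
    have h2 : quarterFactorizations M = ∅ := by
      refine eq_empty_of_forall_notMem fun ⟨a, b⟩ hp => ?_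
      rw [mem_quarterFactorizations] at hp
      have := mul_pos hp.1 hp.2.1
      omega
    simp [h1, h2]
  · have h1 : #(oddSquareReps 4 4) = 16 := by
      have : oddSquareReps 4 4 = Fintype.piFinset fun _ => ({1, -1} : Finset ℤ) := by
        ext v
        simp only [mem_oddSquareReps, Fintype.mem_piFinset, mem_insert, mem_singleton,
          ← sq_eq_one_iff]
        constructor
        · rintro ⟨hodd, hsum⟩
          have hone : ∀ i, 1 ≤ v i ^ 2 := fun i =>
            Int.add_one_le_of_lt
              (sq_pos_of_ne_zero fun h0 : v i = 0 => by simpa [h0] using hodd i)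
          have heq := (sum_eq_sum_iff_of_le fun i (_ : i ∈ univ) => hone i).1 (by simp [hsum])
          exact fun i => (heq i (mem_univ i)).symm
        · intro h
          refine ⟨fun i => ?_, by simp [h]⟩
          rcases sq_eq_one_iff.1 (h i) with h | h <;> simp [h]
      rw [this, Fintype.card_piFinset]
      rfl
    have h2 : quarterFactorizations 4 = {(1, 1)} := by decide
    simp [h1, h2]
  · intro N hN
    have h1 := card_oddSquareReps_recurrence 4 N
    have h2 := sum_quarterFactorizations_recurrence (not_isSquare_of_emod_eight_eq_five hN)
    have h3 : ∑ x ∈ Icc (-N) N with Odd x,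
        (N - 5 * x ^ 2) * ∑ p ∈ quarterFactorizations (N - x ^ 2), p.1 = 0 := by
      rw [← h2]
      refine sum_subset (filter_subset _ _) fun x hx hx' => ?_
      have hxe : Even x := by
        rw [← Int.not_odd_iff_even]
        exact fun h => hx' (mem_filter.2 ⟨hx, h⟩)
      have : quarterFactorizations (N - x ^ 2) = ∅ := by
        refine eq_empty_of_forall_notMem fun ⟨a, b⟩ hp => ?_
        rw [mem_quarterFactorizations] at hp
        obtain ⟨c, rfl⟩ := hxe
        have := hp.2.2
        ring_nf at this
        omega
      rw [this, sum_empty, mul_zero]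
    norm_num at h1
    simp only [mul_sub, sum_sub_distrib, h1, mul_left_comm _ (16 : ℤ), ← mul_sum _ _ (16 : ℤ), h3]
    simp

theorem sum_quarterFactorizations_four_mul (m : ℕ) (hpos : 0 < m) :
    ∑ p ∈ quarterFactorizations (4 * m), p.1 = ((∑ d ∈ m.divisors, d : ℕ) : ℤ) := by
  rw [Nat.cast_sum]
  refine sum_nbij' (fun p => p.1.toNat) (fun d => ((d : ℤ), ((m / d : ℕ) : ℤ)))
    ?_ ?_ ?_ ?_ ?_
  · rintro ⟨a, b⟩ h
    rw [mem_quarterFactorizations] at h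
    lift a to ℕ using h.1.le
    lift b to ℕ using h.2.1.le
    have hab : a * b = m := by exact_mod_cast mul_left_cancel₀ four_ne_zero h.2.2
    simpa [hpos.ne'] using Dvd.intro b hab
  · intro d h
    have hd := Nat.dvd_of_mem_divisors h
    have hm : (d : ℤ) * ((m / d : ℕ) : ℤ) = m := by exact_mod_cast Nat.mul_div_cancel' hd
    rw [mem_quarterFactorizations]
    exact ⟨by exact_mod_cast Nat.pos_of_mem_divisors h,
      by exact_mod_cast Nat.div_pos (Nat.le_of_dvd hpos hd) (Nat.pos_of_mem_divisors h),
      by rw [hm]⟩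
  · rintro ⟨a, b⟩ h
    rw [mem_quarterFactorizations] at h
    lift a to ℕ using h.1.le
    lift b to ℕ using h.2.1.le
    have hab : a * b = m := by exact_mod_cast mul_left_cancel₀ four_ne_zero h.2.2
    have ha : 0 < a := by exact_mod_cast h.1
    simp [← hab, Nat.mul_div_cancel_left b ha]
  · intro d _
    simp
  · rintro ⟨a, b⟩ h
    rw [mem_quarterFactorizations] at h
    exact (Int.toNat_of_nonneg h.1.le).symm

/-- The substitution `(x, y, z, w) ↦ (x, y, z + w, z - w)` identifies the representations by
`x² + y² + 2z² + 2w²` with `x, y` odd and `z, w` of different parity with the representations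
as a sum of four odd squares. -/
def mixedRepsEquiv (M : ℤ) :
    {v : ℤ × ℤ × ℤ × ℤ //
        v.1 ^ 2 + v.2.1 ^ 2 + 2 * v.2.2.1 ^ 2 + 2 * v.2.2.2 ^ 2 = M ∧
        Odd v.1 ∧ Odd v.2.1 ∧
        ((Even v.2.2.1 ∧ Odd v.2.2.2) ∨ (Odd v.2.2.1 ∧ Even v.2.2.2))} ≃
      oddSquareReps 4 M where
  toFun v := ⟨![v.1.1, v.1.2.1, v.1.2.2.1 + v.1.2.2.2, v.1.2.2.1 - v.1.2.2.2], by
    obtain ⟨⟨x, y, z, w⟩, h, hx, hy, hzw⟩ := v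
    simp only at h hx hy hzw
    simp only [mem_oddSquareReps, Fin.forall_fin_succ, Fin.sum_univ_four]
    simp [hx, hy, Int.odd_add, Int.odd_sub]
    grind⟩
  invFun v := ⟨(v.1 0, v.1 1, (v.1 2 + v.1 3) / 2, (v.1 2 - v.1 3) / 2), by
    obtain ⟨v, hv⟩ := v
    rw [mem_oddSquareReps, Fin.sum_univ_four] at hv
    obtain ⟨hodd, h⟩ := hv
    obtain ⟨k, hk⟩ := hodd 2
    obtain ⟨l, hl⟩ := hodd 3
    have h1 : (v 2 + v 3) / 2 = k + l + 1 := by omega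
    have h2 : (v 2 - v 3) / 2 = k - l := by omega
    simp only [h1, h2]
    refine ⟨?_, hodd 0, hodd 1, ?_⟩
    · rw [← h, hk, hl]
      ring
    · simp only [Int.even_iff, Int.odd_iff]
      omega⟩
  left_inv := by
    rintro ⟨⟨x, y, z, w⟩, h⟩
    simp only [Subtype.mk.injEq, Prod.mk.injEq, Matrix.cons_val]
    refine ⟨trivial, trivial, ?_, ?_⟩ <;> omega
  right_inv := by
    rintro ⟨v, hv⟩
    rw [mem_oddSquareReps] at hv
    obtain ⟨k, hk⟩ := hv.1 2
    obtain ⟨l, hl⟩ := hv.1 3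
    ext i
    fin_cases i
    · rfl
    · rfl
    · simp
      omega
    · simp
      omega

end

/-- For `m` odd and positive, the number of representations of `4m` by
`x² + y² + 2z² + 2w²` with `x, y` odd while `z, w` have different parity is `16σ(m)`. -/
theorem representation_count_four_m_odd_odd_mixed (m : ℕ) (hm : Odd m) (hpos : 0 < m) :
    Nat.card {v : ℤ × ℤ × ℤ × ℤ //
        v.1 ^ 2 + v.2.1 ^ 2 + 2 * v.2.2.1 ^ 2 + 2 * v.2.2.2 ^ 2 = (4 * m : ℤ) ∧
        Odd v.1 ∧ Odd v.2.1 ∧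
        ((Even v.2.2.1 ∧ Odd v.2.2.2) ∨ (Odd v.2.2.1 ∧ Even v.2.2.2))} =
      16 * ∑ d ∈ m.divisors, d := by
  rw [Nat.card_congr (mixedRepsEquiv _), Nat.card_eq_fintype_card, Fintype.card_coe]
  have h := card_oddSquareReps_four_eq_sum m hm
  rw [sum_quarterFactorizations_four_mul m hpos] at h
  exact_mod_cast h
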